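/- Let X = ℝ² with norm ‖(x₁,x₂)‖ equal to the ℓ¹ norm when x₁x₂ ≤ 0 and the ℓ∞ norm when x₁x₂ ≥ 0. Then for t ≥ 1: J_t[τ,X] = (((τ+1)^t + τ^t)/2)^(1/t) if τ ≥ 1, and J_t[τ,X] = (((τ+1)^t + 1)/2)^(1/t) if 0 ≤ τ ≤ 1. -/

import Mathlib

open Real

noncomputable def skewJames (X : Type*) [NormedAddCommGroup X] [NormedSpace ℝ X]
    (t τ : ℝ) : ℝ :=
  sSup {r : ℝ | ∃ x y : X, ‖x‖ = 1 ∧ ‖y‖ = 1 ∧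
    r = ((‖x + τ • y‖ ^ t + ‖τ • x - y‖ ^ t) / 2) ^ (1 / t)}

/-- The norm equal to `ℓ¹` on the second and fourth quadrants and to `ℓ∞` on the others is the
hexagonal norm `max |a| |b| |a - b|`. -/
theorem abs_add_abs_eq_max_of_mul_nonpos {a b : ℝ} (h : a * b ≤ 0) :
    |a| + |b| = max (max |a| |b|) |a - b| := by
  have hab : |a - b| = |a| + |b| := by
    rcases mul_nonpos_iff.1 h with ⟨ha, hb⟩ | ⟨ha, hb⟩
    · rw [abs_of_nonneg ha, abs_of_nonpos hb, abs_of_nonneg (by linarith)]; ring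
    · rw [abs_of_nonpos ha, abs_of_nonneg hb, abs_of_nonpos (by linarith)]; ring
  rw [hab, max_eq_right]
  exact max_le (by linarith [abs_nonneg b]) (by linarith [abs_nonneg a])

theorem max_abs_eq_max_of_mul_nonneg {a b : ℝ} (h : 0 ≤ a * b) :
    max |a| |b| = max (max |a| |b|) |a - b| := by
  refine (max_eq_left (le_max_iff.2 ?_)).symm
  rcases mul_nonneg_iff.1 h with ⟨ha, hb⟩ | ⟨ha, hb⟩
  · rcases le_total a b with hab | hab
    · right; rw [abs_of_nonneg hb, abs_of_nonpos (by linarith)]; linarith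
    · left; rw [abs_of_nonneg ha, abs_of_nonneg (by linarith)]; linarith
  · rcases le_total a b with hab | hab
    · left; rw [abs_of_nonpos ha, abs_of_nonpos (by linarith)]; linarith
    · right; rw [abs_of_nonpos hb, abs_of_nonneg (by linarith)]; linarith

theorem hexagonal_add_le {a b c d τ : ℝ} (hτ : 0 ≤ τ)
    (hx : max (max |a| |b|) |a - b| ≤ 1) (hy : max (max |c| |d|) |c - d| ≤ 1) :
    max (max |a + τ * c| |b + τ * d|) |a + τ * c - (b + τ * d)| +
      max (max |τ * a - c| |τ * b - d|) |τ * a - c - (τ * b - d)| ≤ τ + 1 + max 1 τ := by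
  simp only [max_le_iff, abs_le] at hx hy
  obtain ⟨⟨⟨a₁, a₂⟩, b₁, b₂⟩, e₁, e₂⟩ := hx
  obtain ⟨⟨⟨c₁, c₂⟩, d₁, d₂⟩, f₁, f₂⟩ := hy
  have key : ∀ σ : ℝ, 0 ≤ σ → (-σ ≤ σ * a ∧ σ * a ≤ σ) ∧ (-σ ≤ σ * b ∧ σ * b ≤ σ) ∧
      (-σ ≤ σ * a - σ * b ∧ σ * a - σ * b ≤ σ) ∧ (-σ ≤ σ * c ∧ σ * c ≤ σ) ∧
      (-σ ≤ σ * d ∧ σ * d ≤ σ) ∧ (-σ ≤ σ * c - σ * d ∧ σ * c - σ * d ≤ σ) := by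
    intro σ hσ
    refine ⟨⟨?_, ?_⟩, ⟨?_, ?_⟩, ⟨?_, ?_⟩, ⟨?_, ?_⟩, ⟨?_, ?_⟩, ?_, ?_⟩ <;> nlinarith
  obtain ⟨⟨_, _⟩, ⟨_, _⟩, ⟨_, _⟩, ⟨_, _⟩, ⟨_, _⟩, _, _⟩ := key τ hτ
  rw [← le_sub_iff_add_le]
  simp only [max_le_iff, abs_le']
  rcases le_total τ 1 with h | h
  · obtain ⟨⟨_, _⟩, ⟨_, _⟩, ⟨_, _⟩, ⟨_, _⟩, ⟨_, _⟩, _, _⟩ := key (1 - τ) (by linarith)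
    rw [max_eq_left h]
    refine ⟨⟨⟨?_, ?_⟩, ?_, ?_⟩, ?_, ?_⟩ <;> rw [le_sub_comm] <;>
      simp only [max_le_iff, abs_le'] <;>
      refine ⟨⟨⟨?_, ?_⟩, ?_, ?_⟩, ?_, ?_⟩ <;> linarith
  · obtain ⟨⟨_, _⟩, ⟨_, _⟩, ⟨_, _⟩, ⟨_, _⟩, ⟨_, _⟩, _, _⟩ := key (τ - 1) (by linarith)
    rw [max_eq_right h]
    refine ⟨⟨⟨?_, ?_⟩, ?_, ?_⟩, ?_, ?_⟩ <;> rw [le_sub_comm] <;>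
      simp only [max_le_iff, abs_le'] <;>
      refine ⟨⟨⟨?_, ?_⟩, ?_, ?_⟩, ?_, ?_⟩ <;> linarith

/-- Weak majorization for two-term sums of powers. -/
theorem rpow_add_rpow_le_of_add_le {a b P M t : ℝ} (ht : 1 ≤ t) (ha : 0 ≤ a) (hb : 0 ≤ b)
    (hM : 0 ≤ M) (haP : a ≤ P) (hbP : b ≤ P) (hab : a + b ≤ P + M) :
    a ^ t + b ^ t ≤ P ^ t + M ^ t := by
  have ht₀ : 0 ≤ t := by linarith
  rcases le_or_gt b M with hbM | hbM
  · exact add_le_add (rpow_le_rpow ha haP ht₀) (rpow_le_rpow hb hbM ht₀)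
  rcases le_or_gt a M with haM | haM
  · rw [add_comm]
    exact add_le_add (rpow_le_rpow hb hbP ht₀) (rpow_le_rpow ha haM ht₀)
  have hP : 0 < P - M := by linarith
  have chord : ∀ z, M ≤ z → z ≤ P →
      z ^ t ≤ (P - z) / (P - M) * M ^ t + (z - M) / (P - M) * P ^ t := by
    intro z hMz hzP
    have h := (convexOn_rpow ht).2 (Set.mem_Ici.2 hM)
      (Set.mem_Ici.2 (by linarith : 0 ≤ P))
      (div_nonneg (sub_nonneg.2 hzP) hP.le) (div_nonneg (sub_nonneg.2 hMz) hP.le)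
      (by field_simp; ring)
    simp only [smul_eq_mul] at h
    have hz : (P - z) / (P - M) * M + (z - M) / (P - M) * P = z := by
      field_simp
      ring
    rwa [hz] at h
  have hpow : M ^ t ≤ P ^ t := rpow_le_rpow hM (by linarith) ht₀
  have hs : (a - M) / (P - M) + (b - M) / (P - M) ≤ 1 := by
    rw [← add_div, div_le_one hP]; linarith
  have hc : ∀ z, (P - z) / (P - M) = 1 - (z - M) / (P - M) := by
    intro z; field_simp; ring
  have h₁ := chord a haM.le haP
  have h₂ := chord b hbM.le hbP
  rw [hc] at h₁ h₂
  nlinarith [mul_nonneg (sub_nonneg.2 hs) (sub_nonneg.2 hpow)]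

theorem skewJames_eq_of_hexagonal {X : Type*} [NormedAddCommGroup X] [NormedSpace ℝ X]
    (e : X ≃ₗ[ℝ] ℝ × ℝ)
    (hnorm : ∀ x : X, ‖x‖ = max (max |(e x).1| |(e x).2|) |(e x).1 - (e x).2|)
    {t τ : ℝ} (ht : 1 ≤ t) (hτ : 0 ≤ τ) :
    skewJames X t τ = (((τ + 1) ^ t + (max 1 τ) ^ t) / 2) ^ (1 / t) := by
  have ht₀ : 0 ≤ 1 / t := by positivity
  refine IsGreatest.csSup_eq ⟨⟨e.symm (1, 0), e.symm (1, 1), ?_, ?_, ?_⟩, ?_⟩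
  · simp [hnorm]
  · simp [hnorm]
  · have h₁ : ‖e.symm (1, 0) + τ • e.symm (1, 1)‖ = τ + 1 := by
      simp only [hnorm, map_add, map_smul, LinearEquiv.apply_symm_apply, Prod.fst_add,
        Prod.snd_add, Prod.smul_fst, Prod.smul_snd, smul_eq_mul, mul_one, zero_add,
        add_sub_cancel_right, abs_one]
      rw [abs_of_nonneg hτ, abs_of_nonneg (by linarith : 0 ≤ 1 + τ),
        max_eq_left (by linarith : τ ≤ 1 + τ), max_eq_left (by linarith), add_comm]
    have h₂ : ‖τ • e.symm (1, 0) - e.symm (1, 1)‖ = max 1 τ := by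
      simp only [hnorm, map_sub, map_smul, LinearEquiv.apply_symm_apply, Prod.fst_sub,
        Prod.snd_sub, Prod.smul_fst, Prod.smul_snd, smul_eq_mul, mul_one, mul_zero, zero_sub,
        sub_neg_eq_add, sub_add_cancel, abs_neg, abs_one]
      rw [abs_of_nonneg hτ]
      rcases le_total τ 1 with h | h
      · rw [max_eq_right (abs_le.2 ⟨by linarith, by linarith⟩)]
      · rw [max_eq_right h, max_eq_right]
        exact max_le (abs_le.2 ⟨by linarith, by linarith⟩) h
    rw [h₁, h₂]
  · rintro r ⟨x, y, hx, hy, rfl⟩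
    have hsum : ‖x + τ • y‖ + ‖τ • x - y‖ ≤ τ + 1 + max 1 τ := by
      rw [hnorm (x + τ • y), hnorm (τ • x - y)]
      simpa using hexagonal_add_le hτ ((hnorm x).symm.trans hx).le ((hnorm y).symm.trans hy).le
    have h₁ : ‖x + τ • y‖ ≤ τ + 1 := by
      have := norm_add_le x (τ • y)
      rwa [norm_smul, hx, hy, norm_of_nonneg hτ, mul_one, add_comm 1 τ] at this
    have h₂ : ‖τ • x - y‖ ≤ τ + 1 := by
      have := norm_sub_le (τ • x) y
      rwa [norm_smul, hx, hy, norm_of_nonneg hτ, mul_one] at this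
    have := rpow_add_rpow_le_of_add_le ht (norm_nonneg _) (norm_nonneg _)
      (zero_le_one.trans (le_max_left 1 τ)) h₁ h₂ hsum
    exact rpow_le_rpow (by positivity) (by linarith) ht₀

theorem skewJames_l1_linf (X : Type*) [NormedAddCommGroup X] [NormedSpace ℝ X]
    (e : X ≃ₗ[ℝ] ℝ × ℝ)
    (hnorm₁ : ∀ x : X, (e x).1 * (e x).2 ≤ 0 → ‖x‖ = |(e x).1| + |(e x).2|)
    (hnorm₂ : ∀ x : X, 0 ≤ (e x).1 * (e x).2 → ‖x‖ = max |(e x).1| |(e x).2|)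
    (t τ : ℝ) (ht : 1 ≤ t) (hτ : 0 ≤ τ) :
    (1 ≤ τ → skewJames X t τ = (((τ + 1) ^ t + τ ^ t) / 2) ^ (1 / t)) ∧
    (τ ≤ 1 → skewJames X t τ = (((τ + 1) ^ t + 1) / 2) ^ (1 / t)) := by
  have h := skewJames_eq_of_hexagonal e (fun x => by
    rcases le_total ((e x).1 * (e x).2) 0 with hx | hx
    · rw [hnorm₁ x hx, abs_add_abs_eq_max_of_mul_nonpos hx]
    · rw [hnorm₂ x hx, ← max_abs_eq_max_of_mul_nonneg hx]) ht hτ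
  refine ⟨fun h₁ => ?_, fun h₁ => ?_⟩
  · rw [h, max_eq_right h₁]
  · rw [h, max_eq_left h₁, one_rpow]
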